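/- arXiv:2505.17216 — 2 statements merged into one kernel-verified Lean document; each statement's English description precedes it below -/
import Mathlib

section
/- Let N ≥ 2 be an integer and α₁ a nonzero real number. Set c_i := ((i+1)/(2i+1))·α₁ and a_i := ((i−1)/(2i−1))·α₁, and define functions q_i: ℝ → ℝ by q₀(λ) = 1, q₁(λ) = λ/c₂, and q_i(λ) = (1/c_{i+1})·(λ·q_{i−1}(λ) − a_i·q_{i−2}(λ)) for 2 ≤ i ≤ N−1. Then for every i with 1 ≤ i ≤ N−1 and every λ ∈ ℝ, q_i(λ) = (2(2i+3))/(3(i+2)(i+1)) · P'_{i+1}(λ/α₁). -/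
open Polynomial

/-- The Legendre polynomial of degree `n` (Rodrigues' formula), normalized so `P n 1 = 1`. -/
noncomputable def legendre (n : ℕ) : Polynomial ℝ :=
  ((2 ^ n * n.factorial : ℝ))⁻¹ • (derivative^[n] ((X ^ 2 - 1) ^ n))

/-- `c_i = ((i+1)/(2i+1))·α₁`. -/
noncomputable def cc (α1 : ℝ) (i : ℕ) : ℝ := ((i : ℝ) + 1) / (2 * (i : ℝ) + 1) * α1

/-- `a_i = ((i−1)/(2i−1))·α₁`. -/
noncomputable def aa (α1 : ℝ) (i : ℕ) : ℝ := ((i : ℝ) - 1) / (2 * (i : ℝ) - 1) * α1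

/-- The associated polynomial sequence `q_i`:
`q₀ = 1`, `q₁(λ) = λ/c₂`, `q_i(λ) = (1/c_{i+1})(λ q_{i−1}(λ) − a_i q_{i−2}(λ))`. -/
noncomputable def qseq (α1 lam : ℝ) : ℕ → ℝ
  | 0 => 1
  | 1 => lam / cc α1 2
  | (n + 2) => (1 / cc α1 (n + 3)) * (lam * qseq α1 lam (n + 1) - aa α1 (n + 2) * qseq α1 lam n)

theorem legendre_normalization_succ (n : ℕ) :
    (2 ^ (n + 1) * (n + 1).factorial : ℝ)⁻¹ * (2 * ((n : ℝ) + 1)) =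
      (2 ^ n * n.factorial : ℝ)⁻¹ := by
  have hf : (n.factorial : ℝ) ≠ 0 := by positivity
  rw [Nat.factorial_succ]
  push_cast
  field_simp
  ring

/-- Derivative of a Legendre polynomial in terms of the preceding one and its derivative. -/
theorem derivative_legendre_succ (n : ℕ) :
    derivative (legendre (n + 1)) =
      X * derivative (legendre n) + C ((n : ℝ) + 1) * legendre n := by
  have h : derivative ((X ^ 2 - 1 : ℝ[X]) ^ (n + 1)) =
      C (2 * ((n : ℝ) + 1)) * ((X ^ 2 - 1) ^ n * X) := by
    rw [derivative_pow_succ]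
    simp [C_mul, map_ofNat]
    ring
  have h2 : derivative^[n + 2] ((X ^ 2 - 1 : ℝ[X]) ^ (n + 1)) =
      C (2 * ((n : ℝ) + 1)) * (derivative^[n + 1] ((X ^ 2 - 1) ^ n) * X +
        C ((n : ℝ) + 1) * derivative^[n] ((X ^ 2 - 1) ^ n)) := by
    rw [Function.iterate_succ_apply, h, iterate_derivative_C_mul, iterate_derivative_mul_X]
    simp [nsmul_eq_mul]
  simp only [legendre, derivative_smul, ← Function.iterate_succ_apply' (⇑derivative)]
  rw [h2, smul_eq_C_mul, smul_eq_C_mul, smul_eq_C_mul, ← mul_assoc, ← C_mul,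
    legendre_normalization_succ]
  ring

/-- A Legendre polynomial in terms of the derivatives of its two neighbours. -/
theorem derivative_legendre_add_two (n : ℕ) :
    derivative (legendre (n + 2)) =
      C (2 * (n : ℝ) + 3) * legendre (n + 1) + derivative (legendre n) := by
  have h : derivative^[2] ((X ^ 2 - 1 : ℝ[X]) ^ (n + 2)) =
      C (2 * ((n : ℝ) + 2)) * (C (2 * (n : ℝ) + 3) * (X ^ 2 - 1) ^ (n + 1) +
        C (2 * ((n : ℝ) + 1)) * (X ^ 2 - 1) ^ n) := by
    simp only [Function.iterate_succ_apply, Function.iterate_zero, id_eq, derivative_pow_succ,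
      derivative_mul, derivative_sub, derivative_X, derivative_one, derivative_C]
    simp [map_ofNat]
    ring
  have h2 : derivative^[n + 3] ((X ^ 2 - 1 : ℝ[X]) ^ (n + 2)) =
      C (2 * ((n : ℝ) + 2)) *
        (C (2 * (n : ℝ) + 3) * derivative^[n + 1] ((X ^ 2 - 1) ^ (n + 1)) +
          C (2 * ((n : ℝ) + 1)) * derivative^[n + 1] ((X ^ 2 - 1) ^ n)) := by
    rw [show n + 3 = (n + 1) + 2 from rfl, Function.iterate_add_apply, h,
      iterate_derivative_C_mul, iterate_map_add, iterate_derivative_C_mul,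
      iterate_derivative_C_mul]
  have hc := legendre_normalization_succ (n + 1)
  have hcC := congrArg (C : ℝ → ℝ[X]) (legendre_normalization_succ n)
  rw [show 2 * (((n + 1 : ℕ) : ℝ) + 1) = 2 * ((n : ℝ) + 2) by push_cast; ring] at hc
  rw [C_mul] at hcC
  simp only [legendre, derivative_smul, ← Function.iterate_succ_apply' (⇑derivative)]
  rw [h2, smul_eq_C_mul, smul_eq_C_mul, smul_eq_C_mul, ← mul_assoc, ← C_mul, hc]
  linear_combination derivative^[n + 1] ((X ^ 2 - 1 : ℝ[X]) ^ n) * hcC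

/-- Three-term recurrence for the derivatives of the Legendre polynomials. -/
theorem eval_derivative_legendre_recurrence (n : ℕ) (x : ℝ) :
    ((n : ℝ) + 1) * (derivative (legendre (n + 2))).eval x =
      (2 * (n : ℝ) + 3) * x * (derivative (legendre (n + 1))).eval x -
        ((n : ℝ) + 2) * (derivative (legendre n)).eval x := by
  have h1 := congrArg (eval x) (derivative_legendre_succ (n + 1))
  have h2 := congrArg (eval x) (derivative_legendre_add_two n)
  simp only [eval_add, eval_mul, eval_X, eval_C] at h1 h2
  push_cast at h1
  linear_combination (2 * (n : ℝ) + 3) * h1 - ((n : ℝ) + 2) * h2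

theorem derivative_legendre_zero : derivative (legendre 0) = 0 := by
  simp [legendre]

theorem derivative_legendre_one : derivative (legendre 1) = 1 := by
  rw [derivative_legendre_succ 0]
  simp [legendre]

theorem qseq_eq_derivative_legendre {α1 : ℝ} (hα1 : α1 ≠ 0) (lam : ℝ) (i : ℕ) :
    qseq α1 lam i =
      (2 * (2 * (i : ℝ) + 3)) / (3 * ((i : ℝ) + 2) * ((i : ℝ) + 1)) *
        (derivative (legendre (i + 1))).eval (lam / α1) := by
  induction i using Nat.twoStepInduction with
  | zero => norm_num [qseq, derivative_legendre_one]
  | one =>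
    have h := eval_derivative_legendre_recurrence 0 (lam / α1)
    simp only [zero_add, derivative_legendre_zero, derivative_legendre_one, eval_one, eval_zero,
      Nat.cast_zero] at h
    norm_num at h
    norm_num [qseq, cc, h]
    field_simp
    norm_num
  | more n ih1 ih2 =>
    have h := eval_derivative_legendre_recurrence (n + 1) (lam / α1)
    rw [qseq, ih1, ih2, cc, aa]
    push_cast at h ⊢
    have hlam : lam = lam / α1 * α1 := by field_simp
    generalize lam / α1 = x at *
    have hP : (derivative (legendre (n + 2 + 1))).eval x =
        ((2 * ((n : ℝ) + 1) + 3) * x * (derivative (legendre (n + 1 + 1))).eval x -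
        ((n : ℝ) + 1 + 2) * (derivative (legendre (n + 1))).eval x) / ((n : ℝ) + 1 + 1) := by
      rw [eq_div_iff (by positivity)]
      linear_combination h
    rw [hP, hlam]
    have h3 : 2 * ((n : ℝ) + 2) - 1 = 2 * n + 3 := by ring
    have h4 : (n : ℝ) + 2 - 1 = n + 1 := by ring
    rw [h3, h4]
    field_simp
    ring

/-- Closed form of the associated polynomial sequence in terms of derivatives of
Legendre polynomials. -/
theorem stmt_2 (N : ℕ) (hN : 2 ≤ N) (α1 : ℝ) (hα1 : α1 ≠ 0)
    (i : ℕ) (hi1 : 1 ≤ i) (hi2 : i ≤ N - 1) (lam : ℝ) :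
    qseq α1 lam i =
      (2 * (2 * (i : ℝ) + 3)) / (3 * ((i : ℝ) + 2) * ((i : ℝ) + 1)) *
        (derivative (legendre (i + 1))).eval (lam / α1) := by
  exact qseq_eq_derivative_legendre hα1 lam i
end

section
/- Let N ≥ 2 be an integer, g, u_m, α₁, …, α_N real numbers, and h a nonzero real number. Then T · A^{PHSWME}_p · T⁻¹ = A^{PHSWME}_c, where T, A^{PHSWME}_p and A^{PHSWME}_c are the matrices defined in the context. -/
/-- Entry `(i,j)` (0-based) of the tridiagonal matrix `A₂`. -/
noncomputable def A2entry (α1 : ℝ) (i j : ℕ) : ℝ :=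
  if j = i + 1 then ((i : ℝ) + 3) / (2 * (i : ℝ) + 5) * α1
  else if i = j + 1 then ((j : ℝ) + 1) / (2 * (j : ℝ) + 3) * α1
  else 0

/-- Transformation matrix `T` between primitive and convective variables. -/
noncomputable def Tmat (N : ℕ) (h um : ℝ) (α : ℕ → ℝ) :
    Matrix (Fin (N + 2)) (Fin (N + 2)) ℝ := fun r c =>
  if c.val = 0 then (if r.val = 0 then 1 else if r.val = 1 then um else α (r.val - 1))
  else if r = c then h else 0

/-- The PHSWME system matrix in primitive variables. -/
noncomputable def APHSWMEp (N : ℕ) (g h um α1 : ℝ) :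
    Matrix (Fin (N + 2)) (Fin (N + 2)) ℝ := fun r c =>
  if r.val = 0 then (if c.val = 0 then um else if c.val = 1 then h else 0)
  else if r.val = 1 then
    (if c.val = 0 then g + α1 ^ 2 / (3 * h)
     else if c.val = 1 then um
     else if c.val = 2 then 2 / 3 * α1 else 0)
  else if c.val = 0 then (if r.val = 3 then -(α1 ^ 2) / (3 * h) else 0)
  else if c.val = 1 then (if r.val = 2 then α1 else 0)
  else (if r = c then um else 0) + A2entry α1 (r.val - 2) (c.val - 2)

/-- The PHSWME system matrix in convective variables; for `r.val = 1 + i`, `i = 1,…,N`,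
the first column is
`−u_m·α_i − u_m·α₁·δ_{i,1} − (α₁²/3)·δ_{i,2} − ((i−1)/(2i−1))·α₁·α_{i−1} − ((i+2)/(2i+3))·α₁·α_{i+1}`
and the second column is `α_i + α₁·δ_{i,1}`. -/
noncomputable def APHSWMEc (N : ℕ) (g h um : ℝ) (α : ℕ → ℝ) :
    Matrix (Fin (N + 2)) (Fin (N + 2)) ℝ := fun r c =>
  if r.val = 0 then (if c.val = 1 then 1 else 0)
  else if r.val = 1 then
    (if c.val = 0 then g * h - um ^ 2 - (α 1) ^ 2 / 3
     else if c.val = 1 then 2 * um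
     else if c.val = 2 then 2 / 3 * α 1 else 0)
  else if c.val = 0 then
    -um * α (r.val - 1) - um * α 1 * (if r.val = 2 then 1 else 0)
      - (α 1) ^ 2 / 3 * (if r.val = 3 then 1 else 0)
      - ((r.val : ℝ) - 2) / (2 * (r.val : ℝ) - 3) * α 1 * α (r.val - 2)
      - ((r.val : ℝ) + 1) / (2 * (r.val : ℝ) + 1) * α 1 * α r.val
  else if c.val = 1 then α (r.val - 1) + α 1 * (if r.val = 2 then 1 else 0)
  else (if r = c then um else 0) + A2entry (α 1) (r.val - 2) (c.val - 2)

theorem sum_A2entry_mul (N : ℕ) (a : ℝ) (α : ℕ → ℝ) (hαtop : α (N + 1) = 0)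
    (i : ℕ) (hi : i < N) :
    ∑ k : Fin N, A2entry a i k * α (k + 1) =
      ((i : ℝ) + 3) / (2 * (i : ℝ) + 5) * a * α (i + 2) + (i : ℝ) / (2 * (i : ℝ) + 1) * a * α i := by
  rw [Fin.sum_univ_eq_sum_range (fun k => A2entry a i k * α (k + 1)) N]
  have hsplit : ∀ k, A2entry a i k * α (k + 1) =
      (if k = i + 1 then ((i : ℝ) + 3) / (2 * (i : ℝ) + 5) * a * α (i + 2) else 0) +
      (if i = k + 1 then (i : ℝ) / (2 * (i : ℝ) + 1) * a * α i else 0) := by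
    intro k
    unfold A2entry
    by_cases h1 : k = i + 1
    · subst h1
      simp [show i ≠ i + 1 + 1 by omega]
    · by_cases h2 : i = k + 1
      · subst h2
        simp only [h1, if_false, if_true]
        push_cast
        ring_nf
      · simp [h1, h2]
  simp only [hsplit, Finset.sum_add_distrib]
  congr 1
  · rw [Finset.sum_ite_eq', ite_eq_left_iff]
    intro hmem
    rw [show i + 2 = N + 1 by simp at hmem; omega, hαtop, mul_zero]
  · cases i with
    | zero => simp
    | succ j =>
      simp only [Nat.add_right_cancel_iff]
      rw [Finset.sum_ite_eq, if_pos (Finset.mem_range.2 (by omega))]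

theorem det_Tmat_ne_zero (N : ℕ) (h um : ℝ) (hh : h ≠ 0) (α : ℕ → ℝ) :
    (Tmat N h um α).det ≠ 0 := by
  rw [Matrix.det_of_isLowerTriangular]
  · refine Finset.prod_ne_zero_iff.2 fun i _ => ?_
    by_cases hi : i.val = 0 <;> simp [Tmat, hi, hh]
  · intro i j hij
    have hlt : i < j := hij
    have hj : j.val ≠ 0 := by have := Fin.lt_def.1 hlt; omega
    simp only [Tmat, hj, hlt.ne, if_false]

theorem Tmat_mul_apply (N : ℕ) (h um : ℝ) (α : ℕ → ℝ)
    (M : Matrix (Fin (N + 2)) (Fin (N + 2)) ℝ) (r c : Fin (N + 2)) :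
    (Tmat N h um α * M) r c =
      Tmat N h um α r 0 * M 0 c + (if r = 0 then 0 else h * M r c) := by
  rw [Matrix.mul_apply, Fin.sum_univ_succ]
  congr 1
  cases r using Fin.cases with
  | zero => simp [Tmat, (Fin.succ_ne_zero _).symm]
  | succ r => simp [Tmat]

theorem mul_Tmat_apply_succ (N : ℕ) (h um : ℝ) (α : ℕ → ℝ)
    (M : Matrix (Fin (N + 2)) (Fin (N + 2)) ℝ) (r : Fin (N + 2)) (c : Fin (N + 1)) :
    (M * Tmat N h um α) r c.succ = M r c.succ * h := by
  simp [Matrix.mul_apply, Tmat]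

theorem mul_Tmat_apply_zero (N : ℕ) (h um : ℝ) (α : ℕ → ℝ)
    (M : Matrix (Fin (N + 2)) (Fin (N + 2)) ℝ) (r : Fin (N + 2)) :
    (M * Tmat N h um α) r 0 =
      M r 0 + M r 1 * um + ∑ k : Fin N, M r k.succ.succ * α (k + 1) := by
  simp [Matrix.mul_apply, Tmat, Fin.sum_univ_succ, add_assoc]

theorem Tmat_mul_APHSWMEp (N : ℕ) (hN : 2 ≤ N) (g um h : ℝ) (hh : h ≠ 0) (α : ℕ → ℝ)
    (hαtop : α (N + 1) = 0) :
    Tmat N h um α * APHSWMEp N g h um (α 1) = APHSWMEc N g h um α * Tmat N h um α := by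
  ext r c
  rw [Tmat_mul_apply]
  cases c using Fin.cases with
  | zero =>
    rw [mul_Tmat_apply_zero]
    cases r using Fin.cases with
    | zero => simp [Tmat, APHSWMEp, APHSWMEc]
    | succ r =>
      cases r using Fin.cases with
      | zero =>
        obtain ⟨n, rfl⟩ : ∃ n, N = n + 1 := ⟨N - 1, by omega⟩
        simp [Tmat, APHSWMEp, APHSWMEc]
        field_simp
        ring
      | succ i =>
        have hsum : ∑ k : Fin N, APHSWMEc N g h um α i.succ.succ k.succ.succ * α (k + 1) =
            um * α (i + 1) + ∑ k : Fin N, A2entry (α 1) i k * α (k + 1) := by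
          simp [APHSWMEc, add_mul, Finset.sum_add_distrib]
        rw [hsum, sum_A2entry_mul N _ α hαtop i i.2]
        have e1 : ((i : ℝ) + 1 + 1 - 2) / (2 * ((i : ℝ) + 1 + 1) - 3) = i / (2 * i + 1) := by
          congr 1 <;> ring
        have e2 : ((i : ℝ) + 1 + 1 + 1) / (2 * ((i : ℝ) + 1 + 1) + 1) = (i + 3) / (2 * i + 5) := by
          congr 1 <;> ring
        simp [Tmat, APHSWMEp, APHSWMEc, e1, e2]
        split_ifs <;> field_simp <;> ring
  | succ c =>
    rw [mul_Tmat_apply_succ]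
    cases r using Fin.cases with
    | zero => simp [Tmat, APHSWMEp, APHSWMEc]
    | succ r =>
      cases r using Fin.cases with
      | zero =>
        simp [Tmat, APHSWMEp, APHSWMEc]
        split_ifs <;> first | omega | ring
      | succ i =>
        simp [Tmat, APHSWMEp, APHSWMEc]
        split_ifs <;> first | omega | ring

/-- Transforming the primitive PHSWME system matrix back to convective variables yields the
convective PHSWME system matrix (with the conventions `α₀ = 0`, `α_{N+1} = 0`). -/
theorem stmt_13 (N : ℕ) (hN : 2 ≤ N) (g um : ℝ) (h : ℝ) (hh : h ≠ 0) (α : ℕ → ℝ)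
    (hα0 : α 0 = 0) (hαtop : α (N + 1) = 0) :
    Tmat N h um α * APHSWMEp N g h um (α 1) * (Tmat N h um α)⁻¹ = APHSWMEc N g h um α := by
  rw [Tmat_mul_APHSWMEp N hN g um h hh α hαtop]
  exact Matrix.mul_nonsing_inv_cancel_right _ _ (det_Tmat_ne_zero N h um hh α).isUnit
end
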